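/- Let X be a regular locally noetherian scheme and Z a closed subscheme. Then Z is a strictly monomial divisor (i.e. locally cut out by a product ∏ tᵢ^{mᵢ} of members of a regular system of parameters) if and only if Z is an effective Cartier divisor whose reduction Z_red is a strict normal crossings divisor. -/

import Mathlib

universe u

open AlgebraicGeometry CategoryTheory Opposite IsLocalRing

/-- A local ring `A` is *regular* if its maximal ideal can be generated by
`dim A` elements, where `dim A` is the Krull dimension of `A`. -/
def IsRegularLocal (A : Type*) [CommRing A] : Prop :=
  ∃ _ : IsLocalRing A, ∃ s : Finset A,
    Ideal.span (s : Set A) = maximalIdeal A ∧ (s.card : WithBot ℕ∞) = ringKrullDim A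

/-- A finite family of elements of a local ring is *part of a regular system of
parameters* if its members lie in the maximal ideal and their images in the cotangent
space `m/m²` are linearly independent over the residue field. -/
def IsPartOfRegularSystemOfParameters (A : Type*) [CommRing A] [IsLocalRing A]
    {n : ℕ} (t : Fin n → A) : Prop :=
  ∃ h : ∀ i, t i ∈ maximalIdeal A,
    LinearIndependent (ResidueField A)
      (fun i => (maximalIdeal A).toCotangent ⟨t i, h i⟩)

/-- An ideal of a local ring is *strictly monomial* if it is generated by a monomial
`∏ tᵢ^{mᵢ}` (with all `mᵢ ≥ 1`) in part of a regular system of parameters. -/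
def IsStrictlyMonomialIdeal (A : Type*) [CommRing A] [IsLocalRing A] (J : Ideal A) : Prop :=
  ∃ (n : ℕ) (t : Fin n → A) (m : Fin n → ℕ),
    IsPartOfRegularSystemOfParameters A t ∧ (∀ i, 0 < m i) ∧
      J = Ideal.span {∏ i, t i ^ m i}

/-- An ideal of a local ring cuts out a *strict normal crossings* divisor (locally) if
it is generated by a product `t₁⋯tₙ` of part of a regular system of parameters. -/
def IsSNCIdeal (A : Type*) [CommRing A] [IsLocalRing A] (J : Ideal A) : Prop :=
  ∃ (n : ℕ) (t : Fin n → A),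
    IsPartOfRegularSystemOfParameters A t ∧ J = Ideal.span {∏ i, t i}

/-- Quotienting a Noetherian local ring by an element of `m \ m²` lowers the minimal number of
generators of the maximal ideal. -/
theorem spanFinrank_maximalIdeal_quotient_span_singleton_lt {A : Type*} [CommRing A]
    [IsLocalRing A] [IsNoetherianRing A] {x : A} (hx : x ∈ maximalIdeal A)
    (hx2 : x ∉ maximalIdeal A ^ 2) [IsLocalRing (A ⧸ Ideal.span {x})] :
    (maximalIdeal (A ⧸ Ideal.span {x})).spanFinrank < (maximalIdeal A).spanFinrank := by
  classical
  have hne : (maximalIdeal A).toCotangent ⟨x, hx⟩ ≠ 0 := by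
    rwa [Ne, Ideal.toCotangent_eq_zero]
  obtain ⟨b, -, hxb, hspan, hli⟩ := exists_linearIndepOn_extension
    (K := ResidueField A) (v := fun y => (maximalIdeal A).toCotangent y)
    (s := {⟨x, hx⟩}) (t := Set.univ) (by simpa using hne) (Set.subset_univ _)
  rw [Set.image_univ, Set.range_eq_univ.mpr (maximalIdeal A).toCotangent_surjective,
    Set.univ_subset_iff, ← Submodule.top_coe (R := ResidueField A), SetLike.coe_set_eq] at hspan
  have hgen := CotangentSpace.span_image_eq_top_iff.mp hspan
  have hfin : b.Finite := Set.finite_coe_iff.mp (LinearIndependent.finite_of_isNoetherian hli)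
  have hcard : b.ncard ≤ (maximalIdeal A).spanFinrank := by
    rw [spanFinrank_maximalIdeal_eq_finrank_cotangentSpace]
    have := hfin.fintype
    rw [← Nat.card_coe_set_eq, Nat.card_eq_fintype_card]
    exact LinearIndependent.fintype_card_le_finrank hli
  set f := Ideal.Quotient.mk (Ideal.span {x})
  have hmap : maximalIdeal (A ⧸ Ideal.span {x}) =
      Ideal.span ((fun y : maximalIdeal A => f y) '' (b \ {⟨x, hx⟩})) := by
    have hm : maximalIdeal A = Ideal.span (Subtype.val '' b) := by
      have := congrArg (Submodule.map (maximalIdeal A).subtype) hgen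
      rw [Submodule.map_span, Submodule.map_top, Submodule.range_subtype] at this
      exact this.symm
    have hm' : maximalIdeal (A ⧸ Ideal.span {x}) =
        Ideal.span ((fun y : maximalIdeal A => f y) '' b) := by
      rw [← map_maximalIdeal_of_surjective f Ideal.Quotient.mk_surjective]
      refine (congrArg (Ideal.map f) hm).trans ?_
      rw [Ideal.map_span, Set.image_image]
    rw [hm']
    refine le_antisymm (Ideal.span_le.mpr ?_) (Ideal.span_mono (Set.image_mono Set.sdiff_subset))
    rintro _ ⟨y, hy, rfl⟩
    by_cases h : y = ⟨x, hx⟩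
    · have : f y = 0 := by
        rw [h]
        exact Ideal.Quotient.eq_zero_iff_mem.mpr (Ideal.mem_span_singleton_self x)
      simp [this]
    · exact Ideal.subset_span ⟨y, ⟨hy, h⟩, rfl⟩
  rw [hmap]
  calc _ ≤ _ := Submodule.spanFinrank_span_le_ncard_of_finite (hfin.sdiff.image _)
    _ ≤ _ := Set.ncard_image_le hfin.sdiff
    _ < _ := Set.ncard_sdiff_singleton_lt_of_mem (hxb rfl) hfin
    _ ≤ _ := hcard

theorem isLocalRing_quotient_span_singleton {A : Type*} [CommRing A] [IsLocalRing A] {x : A}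
    (hx : x ∈ maximalIdeal A) : IsLocalRing (A ⧸ Ideal.span {x}) := by
  have : Nontrivial (A ⧸ Ideal.span {x}) := Ideal.Quotient.nontrivial_iff.mpr fun h =>
    (maximalIdeal.isMaximal A).ne_top (top_le_iff.mp
      (h ▸ (Ideal.span_singleton_le_iff_mem _).mpr hx))
  exact .of_surjective' _ Ideal.Quotient.mk_surjective

/-- The quotient of a regular local ring by an element of `m \ m²` is regular. -/
theorem IsRegularLocalRing.quotient_span_singleton {A : Type*} [CommRing A] [IsRegularLocalRing A]
    {x : A} (hx : x ∈ maximalIdeal A) (hx2 : x ∉ maximalIdeal A ^ 2) :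
    IsRegularLocalRing (A ⧸ Ideal.span {x}) := by
  have := isLocalRing_quotient_span_singleton hx
  apply IsRegularLocalRing.of_spanFinrank_maximalIdeal_le
  have hlt := spanFinrank_maximalIdeal_quotient_span_singleton_lt hx hx2
  have hdim : ringKrullDim A ≤ ringKrullDim (A ⧸ Ideal.span {x}) + 1 := by
    rw [← maximalIdeal_height_eq_ringKrullDim]
    exact Ideal.height_le_ringKrullDim_quotient_add_one hx
  rw [← (isRegularLocalRing_iff A).mp ‹_›] at hdim
  have h : (((maximalIdeal (A ⧸ Ideal.span {x})).spanFinrank : ℕ) : WithBot ℕ∞) + 1 ≤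
      ringKrullDim (A ⧸ Ideal.span {x}) + 1 := le_trans (mod_cast hlt) hdim
  obtain ⟨d, hd⟩ := WithBot.ne_bot_iff_exists.mp
    (ringKrullDim_ne_bot (R := A ⧸ Ideal.span {x}))
  rw [← hd] at h ⊢
  have h' : (((maximalIdeal (A ⧸ Ideal.span {x})).spanFinrank : ℕ) : ℕ∞) + 1 ≤ d + 1 := mod_cast h
  exact_mod_cast (ENat.add_le_add_iff_right ENat.one_ne_top).mp h'

/-- In a Noetherian local ring whose maximal ideal is not a minimal prime, some element of `m \ m²` avoids all minimal primes. -/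
theorem exists_mem_maximalIdeal_notMem_sq_notMem_minimalPrimes {A : Type*} [CommRing A]
    [IsLocalRing A] [IsNoetherianRing A] (hmin : maximalIdeal A ∉ minimalPrimes A) :
    ∃ x ∈ maximalIdeal A, x ∉ maximalIdeal A ^ 2 ∧ ∀ p ∈ minimalPrimes A, x ∉ p := by
  classical
  by_contra! hcon
  have hfin : (minimalPrimes A).Finite := minimalPrimes.finite_of_isNoetherianRing A
  have hsub : (maximalIdeal A : Set A) ⊆
      ⋃ p ∈ ((insert (maximalIdeal A ^ 2) hfin.toFinset : Finset (Ideal A)) : Set (Ideal A)),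
        ((id p : Ideal A) : Set A) := by
    intro x hx
    by_cases h2 : x ∈ maximalIdeal A ^ 2
    · exact Set.mem_biUnion (by simp) h2
    · obtain ⟨p, hp, hxp⟩ := hcon x hx h2
      exact Set.mem_biUnion (by simp [hp]) hxp
  rw [Ideal.subset_union_prime (maximalIdeal A ^ 2) (maximalIdeal A ^ 2)] at hsub
  · obtain ⟨p, hp, hle⟩ := hsub
    rcases Finset.mem_insert.mp hp with rfl | hp
    · have hbot : maximalIdeal A = ⊥ :=
        Submodule.eq_bot_of_le_smul_of_le_jacobson_bot (maximalIdeal A) (maximalIdeal A)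
          (IsNoetherian.noetherian _) (by simpa [sq] using hle)
          (IsLocalRing.maximalIdeal_le_jacobson _)
      exact hmin ⟨⟨inferInstance, bot_le⟩, fun q _ _ => hbot ▸ bot_le⟩
    · have hp' := hfin.mem_toFinset.mp hp
      have : maximalIdeal A = p := le_antisymm hle (le_maximalIdeal hp'.1.1.ne_top)
      exact hmin (this ▸ hp')
  · intro p hp hne _
    exact (hfin.mem_toFinset.mp ((Finset.mem_insert.mp hp).resolve_left hne)).1.1

/-- A regular local ring is a domain. -/
theorem IsRegularLocalRing.isDomain {A : Type*} [CommRing A] [IsRegularLocalRing A] :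
    IsDomain A := by
  induction hd : (maximalIdeal A).spanFinrank using Nat.strong_induction_on generalizing A with
  | _ d ih =>
  subst hd
  by_cases hmin : maximalIdeal A ∈ minimalPrimes A
  · have h0 : (maximalIdeal A).spanFinrank = 0 := by
      have h := (isRegularLocalRing_iff A).mp ‹_›
      rw [← maximalIdeal_height_eq_ringKrullDim, Ideal.height_eq_zero_iff.mpr hmin] at h
      exact_mod_cast h
    have hbot := (Submodule.spanFinrank_eq_zero_iff_eq_bot (IsNoetherian.noetherian _)).mp h0
    exact (isField_iff_maximalIdeal_eq.mpr hbot).isDomain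
  · obtain ⟨x, hx, hx2, hxp⟩ := exists_mem_maximalIdeal_notMem_sq_notMem_minimalPrimes hmin
    have := IsRegularLocalRing.quotient_span_singleton hx hx2
    have : IsDomain (A ⧸ Ideal.span {x}) :=
      ih _ (spanFinrank_maximalIdeal_quotient_span_singleton_lt hx hx2) rfl
    have hprime : (Ideal.span {x}).IsPrime := (Ideal.Quotient.isDomain_iff_prime _).mp this
    obtain ⟨p, hp, hple⟩ := Ideal.exists_minimalPrimes_le (bot_le : ⊥ ≤ Ideal.span {x})
    have hpp : p.IsPrime := hp.1.1
    have hbot : p = ⊥ := by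
      refine Submodule.eq_bot_of_le_smul_of_le_jacobson_bot (Ideal.span {x}) p
        (IsNoetherian.noetherian _) (fun y hy => ?_)
        (((Ideal.span_singleton_le_iff_mem _).mpr hx).trans
          (IsLocalRing.maximalIdeal_le_jacobson _))
      obtain ⟨z, rfl⟩ := Ideal.mem_span_singleton.mp (hple hy)
      exact Submodule.smul_mem_smul (Ideal.mem_span_singleton_self x)
        ((hpp.mem_or_mem hy).resolve_left (hxp p hp))
    subst hbot
    exact IsDomain.of_bot_isPrime A

/-- An element of `m \ m²` in a regular local ring is prime. -/
theorem IsRegularLocalRing.prime_of_notMem_sq {A : Type*} [CommRing A] [IsRegularLocalRing A]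
    {x : A} (hx : x ∈ maximalIdeal A) (hx2 : x ∉ maximalIdeal A ^ 2) : Prime x := by
  have := IsRegularLocalRing.quotient_span_singleton hx hx2
  have : IsDomain (A ⧸ Ideal.span {x}) := IsRegularLocalRing.isDomain
  refine (Ideal.span_singleton_prime ?_).mp ((Ideal.Quotient.isDomain_iff_prime _).mp this)
  rintro rfl
  exact hx2 (zero_mem _)

theorem IsRegularLocal.isRegularLocalRing {A : Type*} [CommRing A] [IsNoetherianRing A]
    (h : IsRegularLocal A) : IsRegularLocalRing A := by
  obtain ⟨_, s, hs, hcard⟩ := h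
  apply IsRegularLocalRing.of_spanFinrank_maximalIdeal_le
  rw [← hcard, ← hs, ← Set.ncard_coe_finset]
  exact_mod_cast Submodule.spanFinrank_span_le_ncard_of_finite s.finite_toSet

theorem IsPartOfRegularSystemOfParameters.prime {A : Type*} [CommRing A] [IsRegularLocalRing A]
    {n : ℕ} {t : Fin n → A} (ht : IsPartOfRegularSystemOfParameters A t) (i : Fin n) :
    Prime (t i) := by
  obtain ⟨hm, hli⟩ := ht
  exact IsRegularLocalRing.prime_of_notMem_sq (hm i)
    fun h => hli.ne_zero i ((Ideal.toCotangent_eq_zero _ _).mpr h)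

theorem IsPartOfRegularSystemOfParameters.not_dvd {A : Type*} [CommRing A] [IsLocalRing A]
    {n : ℕ} {t : Fin n → A} (ht : IsPartOfRegularSystemOfParameters A t) {i j : Fin n}
    (hij : i ≠ j) : ¬ t i ∣ t j := by
  obtain ⟨hm, hli⟩ := ht
  rintro ⟨c, hc⟩
  have hj : (⟨t j, hm j⟩ : maximalIdeal A) = c • ⟨t i, hm i⟩ :=
    Subtype.ext (by simp [hc, mul_comm])
  refine hli.notMem_span_image (s := {i}) (x := j) (by simpa using hij.symm) ?_
  simp only [Set.image_singleton, hj, map_smul]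
  rw [Submodule.mem_span_singleton]
  exact ⟨residue A c, rfl⟩

/-- A product of pairwise non-dividing primes divides whatever each of them divides. -/
theorem Finset.prod_dvd_of_prime_of_not_dvd {A ι : Type*} [CommMonoidWithZero A] {t : ι → A}
    (hp : ∀ i, Prime (t i)) (hnd : ∀ i j, i ≠ j → ¬ t i ∣ t j) {a : A} (s : Finset ι)
    (h : ∀ i ∈ s, t i ∣ a) : ∏ i ∈ s, t i ∣ a := by
  classical
  induction s using Finset.induction_on with
  | empty => simp
  | insert j s hj ih =>
    obtain ⟨c, rfl⟩ := ih fun i hi => h i (Finset.mem_insert_of_mem hi)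
    rw [Finset.prod_insert hj, mul_comm]
    refine mul_dvd_mul_left _ (((hp j).dvd_or_dvd
      (h j (Finset.mem_insert_self j s))).resolve_left fun hd => ?_)
    obtain ⟨i, hi, hdi⟩ := (hp j).exists_mem_finset_dvd hd
    exact hnd j i (fun e => hj (e ▸ hi)) hdi

/-- A divisor of a product of prime powers is associated to a product of powers of these primes. -/
theorem Finset.exists_associated_prod_pow_of_dvd {A ι : Type*} [CommRing A] [IsDomain A]
    {t : ι → A} (hp : ∀ i, Prime (t i)) (k : ι → ℕ) (s : Finset ι) {a : A}
    (h : a ∣ ∏ i ∈ s, t i ^ k i) : ∃ m : ι → ℕ, Associated a (∏ i ∈ s, t i ^ m i) := by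
  classical
  induction s using Finset.induction_on generalizing a with
  | empty => exact ⟨0, by simpa [associated_one_iff_isUnit, isUnit_iff_dvd_one] using h⟩
  | insert j s hj ih =>
    obtain ⟨b, hb⟩ := h
    rw [Finset.prod_insert hj, mul_comm] at hb
    obtain ⟨e, -, c, d, -, hcd, rfl, -⟩ := mul_eq_mul_prime_pow (hp j) hb.symm
    obtain ⟨m, hm⟩ := ih (Dvd.intro d hcd.symm)
    refine ⟨Function.update m j e, ?_⟩
    rw [Finset.prod_insert hj, Function.update_self, mul_comm (t j ^ e)]
    have hprod : ∏ i ∈ s, t i ^ Function.update m j e i = ∏ i ∈ s, t i ^ m i :=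
      Finset.prod_congr rfl fun i hi => by
        rw [Function.update_of_ne fun h : i = j => hj (h ▸ hi)]
    rw [hprod]
    exact hm.mul_right _

/-- The radical of a monomial ideal in pairwise non-dividing primes. -/
theorem Ideal.radical_span_singleton_prod_pow {A ι : Type*} [CommRing A] [Fintype ι] {t : ι → A}
    (hp : ∀ i, Prime (t i)) (hnd : ∀ i j, i ≠ j → ¬ t i ∣ t j) {m : ι → ℕ} (hm : ∀ i, 0 < m i) :
    (Ideal.span {∏ i, t i ^ m i}).radical = Ideal.span {∏ i, t i} := by
  refine le_antisymm ?_ ?_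
  · rintro a ⟨N, ha⟩
    rw [Ideal.mem_span_singleton] at ha ⊢
    refine Finset.prod_dvd_of_prime_of_not_dvd hp hnd _ fun i _ => ?_
    exact (hp i).dvd_of_dvd_pow (((dvd_pow_self _ (hm i).ne').trans
      (Finset.dvd_prod_of_mem (fun i => t i ^ m i) (Finset.mem_univ i))).trans ha)
  · rw [Ideal.span_singleton_le_iff_mem]
    refine ⟨∑ i, m i, Ideal.mem_span_singleton.mpr ?_⟩
    rw [← Finset.prod_pow]
    exact Finset.prod_dvd_prod_of_dvd _ _ fun i _ =>
      pow_dvd_pow _ (Finset.single_le_sum (fun _ _ => Nat.zero_le _) (Finset.mem_univ i))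

/-- In a regular local ring, an ideal is strictly monomial if and only if it is generated by a
nonzerodivisor and its radical cuts out a strict normal crossings divisor. -/
theorem isStrictlyMonomialIdeal_iff {A : Type*} [CommRing A] [IsRegularLocalRing A]
    (J : Ideal A) : IsStrictlyMonomialIdeal A J ↔
      (∃ a ∈ nonZeroDivisors A, J = Ideal.span {a}) ∧ IsSNCIdeal A J.radical := by
  have : IsDomain A := IsRegularLocalRing.isDomain
  constructor
  · rintro ⟨n, t, m, ht, hm, rfl⟩
    refine ⟨⟨_, mem_nonZeroDivisors_of_ne_zero (Finset.prod_ne_zero_iff.mpr fun i _ =>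
      pow_ne_zero _ (ht.prime i).ne_zero), rfl⟩, n, t, ht, ?_⟩
    exact Ideal.radical_span_singleton_prod_pow ht.prime (fun _ _ => ht.not_dvd) hm
  · rintro ⟨⟨a, -, rfl⟩, n, t, ht, hrad⟩
    obtain ⟨N, hN⟩ : ∏ i, t i ∈ (Ideal.span {a}).radical :=
      hrad ▸ Ideal.mem_span_singleton_self _
    rw [Ideal.mem_span_singleton, ← Finset.prod_pow] at hN
    obtain ⟨m, hm⟩ := Finset.exists_associated_prod_pow_of_dvd ht.prime (fun _ => N) _ hN
    refine ⟨n, t, m, ht, fun i => Nat.pos_of_ne_zero fun hi => ?_,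
      Ideal.span_singleton_eq_span_singleton.mpr hm⟩
    have ha : a ∈ Ideal.span {∏ i, t i} :=
      hrad ▸ Ideal.le_radical (Ideal.mem_span_singleton_self a)
    have hdvd : t i ∣ ∏ j, t j ^ m j := ((Finset.dvd_prod_of_mem t (Finset.mem_univ i)).trans
      (Ideal.mem_span_singleton.mp ha)).trans hm.dvd
    obtain ⟨j, -, hj⟩ := (ht.prime i).exists_mem_finset_dvd hdvd
    by_cases hij : i = j
    · subst hij
      rw [hi, pow_zero] at hj
      exact (ht.prime i).not_isUnit (isUnit_of_dvd_one hj)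
    · exact ht.not_dvd hij ((ht.prime i).dvd_of_dvd_pow hj)

/-- Let `X` be a regular locally noetherian scheme and let `Z` be a closed subscheme,
given by the quasi-coherent family of stalk ideals `I`.  Then `Z` is a strictly
monomial divisor (at every point, its ideal is generated by a monomial in part of a
regular system of parameters) if and only if `Z` is an effective Cartier divisor (each
stalk of `I` is principal, generated by a nonzerodivisor) whose reduction `Z_red`
(with stalk ideals the radicals of those of `Z`) is a strict normal crossings
divisor. -/
theorem isStrictlyMonomial_iff_cartier_and_snc_reduction
    {X : Scheme.{u}} [IsLocallyNoetherian X]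
    (hreg : ∀ x : X, IsRegularLocal (X.presheaf.stalk x))
    (I : ∀ x : X, Ideal (X.presheaf.stalk x))
    (hqc : ∀ x : X, ∃ (U : X.Opens) (_ : x ∈ U) (s : Finset (X.presheaf.obj (op U))),
      ∀ (x' : X) (hx' : x' ∈ U),
        I x' = Ideal.span ((X.presheaf.germ U x' hx') '' (s : Set (X.presheaf.obj (op U))))) :
    (∀ x : X, IsStrictlyMonomialIdeal (X.presheaf.stalk x) (I x)) ↔
      ((∀ x : X, ∃ a : X.presheaf.stalk x,
          a ∈ nonZeroDivisors (X.presheaf.stalk x) ∧ I x = Ideal.span {a}) ∧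
        ∀ x : X, IsSNCIdeal (X.presheaf.stalk x) ((I x).radical)) := by
  rw [← forall_and]
  refine forall_congr' fun x => ?_
  have := (hreg x).isRegularLocalRing
  exact isStrictlyMonomialIdeal_iff (I x)
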